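/- arXiv:2412.01387 — 2 statements merged into one kernel-verified Lean document; each statement's English description precedes it below -/
import Mathlib

section
/- Let X be a Banach space, J = [0,b], and let F : J × X → P_{cp,cv}(X) be an L¹-Carathéodory multivalued map (nonempty compact convex values, t ↦ F(t,x) measurable for each x, x ↦ F(t,x) upper semicontinuous for a.e. t, and for each r > 0 there is φ_r ∈ L¹(J;[0,∞)) with sup{‖v‖ : v ∈ F(t,x)} ≤ φ_r(t) for a.e. t whenever ‖x‖ ≤ r). Assume S_{F,y} := {g ∈ L¹(J,X) : g(t) ∈ F(t,y(t)) for a.e. t ∈ J} is nonempty for every y ∈ C(J,X), and let Λ : L¹(J,X) → C(J,X) be a continuous linear operator. Then the multivalued operator Λ∘S_F : C(J,X) → P(C(J,X)), y ↦ Λ(S_{F,y}), has closed graph: if y_n → y in C(J,X), z_n ∈ Λ(S_{F,y_n}) and z_n → z in C(J,X), then z ∈ Λ(S_{F,y}). -/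
open MeasureTheory Set Filter

/-- Komlos-type lemma: tail convex combinations of a bounded sequence which are Cauchy. -/
lemma aux_hilbert {H : Type*} [NormedAddCommGroup H] [InnerProductSpace ℝ H]
    (u : ℕ → H) (B : ℝ) (hB : ∀ n, ‖u n‖ ≤ B) :
    ∃ c : ℕ → (ℕ →₀ ℝ),
      (∀ k, c k ∈ convexHull ℝ ((fun n => Finsupp.single n (1 : ℝ)) '' Ici k)) ∧
      CauchySeq (fun k => Finsupp.linearCombination ℝ u (c k)) := by
  set L := Finsupp.linearCombination ℝ u
  set C : ℕ → Set (ℕ →₀ ℝ) :=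
    fun k => convexHull ℝ ((fun n => Finsupp.single n (1 : ℝ)) '' Ici k) with hC
  have hCmono : ∀ k l, k ≤ l → C l ⊆ C k := fun k l h =>
    convexHull_mono (image_mono (Ici_subset_Ici.2 h))
  have hsing : ∀ k, Finsupp.single k (1 : ℝ) ∈ C k := fun k =>
    subset_convexHull _ _ ⟨k, mem_Ici.2 le_rfl, rfl⟩
  set S : ℕ → Set ℝ := fun k => (fun c => ‖L c‖) '' C k with hS
  have hSne : ∀ k, (S k).Nonempty := fun k => ⟨_, _, hsing k, rfl⟩
  have hSbdd : ∀ k, BddBelow (S k) := fun k => ⟨0, by rintro _ ⟨c, -, rfl⟩; positivity⟩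
  set d : ℕ → ℝ := fun k => sInf (S k) with hd
  have hdle : ∀ k, ∀ c ∈ C k, d k ≤ ‖L c‖ := fun k c hc => csInf_le (hSbdd k) ⟨c, hc, rfl⟩
  have hd0 : ∀ k, 0 ≤ d k := fun k => le_csInf (hSne k) (by rintro _ ⟨c, -, rfl⟩; positivity)
  have hdm : Monotone d := fun k l h =>
    csInf_le_csInf (hSbdd k) (hSne l) (image_mono (hCmono k l h))
  have hdB : ∀ k, d k ≤ B := fun k => (hdle k _ (hsing k)).trans (by simpa [L] using hB k)
  have hex : ∀ k : ℕ, ∃ c ∈ C k, ‖L c‖ < d k + 1 / ((k : ℝ) + 1) := by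
    intro k
    obtain ⟨_, ⟨c, hc, rfl⟩, h⟩ := exists_lt_of_csInf_lt (hSne k)
      (show sInf (S k) < d k + 1 / ((k : ℝ) + 1) by
        have : (0 : ℝ) < 1 / ((k : ℝ) + 1) := by positivity
        linarith)
    exact ⟨c, hc, h⟩
  choose c hc hcn using hex
  refine ⟨c, hc, ?_⟩
  have hdt : Tendsto d atTop (nhds (⨆ k, d k)) :=
    tendsto_atTop_ciSup hdm ⟨B, by rintro _ ⟨k, rfl⟩; exact hdB k⟩
  set D := ⨆ k, d k
  have hdD : ∀ k, d k ≤ D := fun k => le_ciSup (f := d) ⟨B, by rintro _ ⟨k, rfl⟩; exact hdB k⟩ k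
  have hsq : ∀ k l, k ≤ l → ‖L (c k) - L (c l)‖ ^ 2 ≤
      4 * ((D + 1 / ((k : ℝ) + 1)) ^ 2 - d k ^ 2) := by
    intro k l hkl
    have hp := parallelogram_law_with_norm ℝ (L (c k)) (L (c l))
    have hmid : (1 / 2 : ℝ) • c k + (1 / 2 : ℝ) • c l ∈ C k :=
      convex_convexHull ℝ _ (hc k) (hCmono k l hkl (hc l)) (by norm_num) (by norm_num)
        (by norm_num)
    have h1 := hdle k _ hmid
    rw [← smul_add, map_smul, map_add, norm_smul] at h1
    norm_num at h1
    have hkl' : 1 / ((l : ℝ) + 1) ≤ 1 / ((k : ℝ) + 1) := by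
      have : (k : ℝ) ≤ l := by exact_mod_cast hkl
      gcongr
    have h2 : ‖L (c k)‖ ≤ D + 1 / ((k : ℝ) + 1) := by linarith [hcn k, hdD k]
    have h3 : ‖L (c l)‖ ≤ D + 1 / ((k : ℝ) + 1) := by linarith [hcn l, hdD l]
    have h2' := pow_le_pow_left₀ (norm_nonneg _) h2 2
    have h3' := pow_le_pow_left₀ (norm_nonneg _) h3 2
    have h4 := pow_le_pow_left₀ (hd0 k) h1 2
    nlinarith
  have hlim : Tendsto (fun k : ℕ => Real.sqrt (4 * ((D + 1 / ((k : ℝ) + 1)) ^ 2 - d k ^ 2)))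
      atTop (nhds 0) := by
    have h1 : Tendsto (fun k : ℕ => 1 / ((k : ℝ) + 1)) atTop (nhds 0) :=
      tendsto_one_div_add_atTop_nhds_zero_nat
    have h2 := ((((tendsto_const_nhds (x := D)).add h1).pow 2).sub (hdt.pow 2)).const_mul 4
    have h3 := (Real.continuous_sqrt.tendsto _).comp h2
    simpa [Function.comp_def] using h3
  refine cauchySeq_of_le_tendsto_0' _ (fun k l hkl => ?_) hlim
  rw [dist_eq_norm]
  exact Real.le_sqrt_of_sq_le (hsq k l hkl)

/-- A separable closed subspace embeds continuously into a Hilbert space. -/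
lemma aux_embed {X H : Type*} [NormedAddCommGroup X] [NormedSpace ℝ X]
    [NormedAddCommGroup H] [InnerProductSpace ℝ H] [CompleteSpace H]
    (v : ℕ → H) (hv : Orthonormal ℝ v) (s : Set X)
    (hs : TopologicalSpace.IsSeparable s) :
    ∃ T : X →L[ℝ] H,
      ∀ x ∈ (Submodule.span ℝ s).topologicalClosure, T x = 0 → x = 0 := by
  have hs' : TopologicalSpace.IsSeparable (insert 0 (closure (Submodule.span ℝ s : Set X))) := by
    have h := hs.span (R := ℝ) |>.closure
    rwa [insert_eq_of_mem]
    exact subset_closure (Submodule.zero_mem _)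
  obtain ⟨c, hc, hsc⟩ := hs'
  have hcne : c.Nonempty := by
    rw [← closure_nonempty_iff]
    exact ⟨0, hsc (mem_insert _ _)⟩
  obtain ⟨e, rfl⟩ := hc.exists_eq_range hcne
  choose f hf1 hf2 using fun m => exists_dual_vector'' ℝ (e m)
  let A : ℕ → (X →L[ℝ] H) := fun m => (1 / 2 : ℝ) ^ m • (f m).smulRight (v m)
  have hA : Summable A := by
    refine Summable.of_norm_bounded (g := fun m => (1 / 2 : ℝ) ^ m)
      (summable_geometric_of_lt_one (by norm_num) (by norm_num)) (fun m => ?_)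
    simp only [A]
    rw [norm_smul, ContinuousLinearMap.norm_smulRight_apply, hv.1 m]
    simpa using hf1 m
  obtain ⟨T, hAT⟩ := hA
  refine ⟨T, fun x hx hTx => ?_⟩
  have hfx : ∀ m, f m x = 0 := by
    intro m
    have h1 : HasSum (fun n => A n x) 0 := by
      have := hAT.mapL (ContinuousLinearMap.apply ℝ H x)
      rw [ContinuousLinearMap.apply_apply, hTx] at this
      exact this
    have h2 := h1.mapL (innerSL ℝ (v m))
    have h3 : HasSum (fun n => (innerSL ℝ (v m)) (A n x)) ((innerSL ℝ (v m)) (A m x)) := by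
      refine hasSum_single m (fun n hn => ?_)
      simp [A, hv.2 hn.symm]
    have h4 := h3.unique h2
    simpa [A, inner_smul_right, hv.1 m] using h4
  by_contra hne
  have hpos : 0 < ‖x‖ := norm_pos_iff.2 hne
  obtain ⟨_, ⟨m, rfl⟩, hm⟩ := Metric.mem_closure_iff.1 (hsc (mem_insert_of_mem _ hx)) (‖x‖ / 2)
    (by positivity)
  rw [dist_eq_norm] at hm
  have h1 : ‖e m‖ ≤ ‖x - e m‖ := by
    have : f m (x - e m) = - ‖e m‖ := by rw [map_sub, hfx, hf2]; simp
    have h := (f m).le_of_opNorm_le (hf1 m) (x - e m)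
    rw [this] at h
    simpa using h
  have h2 := norm_sub_norm_le x (e m)
  linarith

/-- Convergence from compactness and separation. -/
lemma aux_conv {X H : Type*} [NormedAddCommGroup X] [NormedSpace ℝ X]
    [NormedAddCommGroup H] [NormedSpace ℝ H] (T : X →L[ℝ] H) (M : Submodule ℝ X)
    (hM : IsClosed (M : Set X)) (hT : ∀ x ∈ M, T x = 0 → x = 0)
    (K : Set X) (hK : IsCompact K) (x : ℕ → X) (hx : ∀ k, x k ∈ M)
    (hxK : ∀ ε > 0, ∀ᶠ k in atTop, x k ∈ Metric.thickening ε K) (τ : H)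
    (hτ : Tendsto (fun k => T (x k)) atTop (nhds τ)) :
    ∃ a ∈ K, Tendsto x atTop (nhds a) := by
  have key : ∀ ns : ℕ → ℕ, Tendsto ns atTop atTop →
      ∃ a ∈ K, a ∈ M ∧ T a = τ ∧ ∃ ms : ℕ → ℕ, Tendsto (fun n => x (ns (ms n))) atTop (nhds a) := by
    intro ns hns
    have hKne : K.Nonempty := by
      obtain ⟨k, hk⟩ := (hxK 1 one_pos).exists
      obtain ⟨z, hz, -⟩ := Metric.mem_thickening_iff.1 hk
      exact ⟨z, hz⟩
    choose p hpK hp using fun k => hK.exists_infDist_eq_dist hKne (x k)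
    have hdist : Tendsto (fun k => dist (x k) (p k)) atTop (nhds 0) := by
      rw [Metric.tendsto_atTop']
      intro ε hε
      obtain ⟨N, hN⟩ := eventually_atTop.1 (hxK ε hε)
      refine ⟨N, fun n hn => ?_⟩
      obtain ⟨z, hz, hz'⟩ := Metric.mem_thickening_iff.1 (hN n hn.le)
      rw [Real.dist_0_eq_abs, abs_of_nonneg dist_nonneg, ← hp]
      exact (Metric.infDist_le_dist_of_mem hz).trans_lt hz'
    obtain ⟨a, haK, ms, hms, hlim⟩ := hK.tendsto_subseq (fun n => hpK (ns n))
    have hcomp := hns.comp hms.tendsto_atTop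
    have hxa : Tendsto (fun n => x (ns (ms n))) atTop (nhds a) :=
      hlim.congr_dist (by
        have := hdist.comp hcomp
        simpa [Function.comp_def, dist_comm] using this)
    refine ⟨a, haK, hM.mem_of_tendsto hxa (Eventually.of_forall fun n => hx _), ?_, ms, hxa⟩
    exact tendsto_nhds_unique ((T.continuous.tendsto a).comp hxa) (hτ.comp hcomp)
  obtain ⟨a, haK, haM, haT, -⟩ := key id tendsto_id
  refine ⟨a, haK, tendsto_of_subseq_tendsto fun ns hns => ?_⟩
  obtain ⟨a', -, haM', haT', ms, hms⟩ := key ns hns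
  have : a' - a = 0 := hT _ (M.sub_mem haM' haM) (by rw [map_sub, haT, haT', sub_self])
  rw [sub_eq_zero] at this
  exact ⟨ms, this ▸ hms⟩

lemma aux_hull {E : Type*} [AddCommGroup E] [Module ℝ E] (u : ℕ → E) (k : ℕ) (c : ℕ →₀ ℝ)
    (hc : c ∈ convexHull ℝ ((fun n => Finsupp.single n (1 : ℝ)) '' Ici k)) (C : Set E)
    (hC : Convex ℝ C) (hu : ∀ n, k ≤ n → u n ∈ C) :
    Finsupp.linearCombination ℝ u c ∈ C := by
  have h : Finsupp.linearCombination ℝ u c ∈ (Finsupp.linearCombination ℝ u) ''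
    convexHull ℝ ((fun n => Finsupp.single n (1 : ℝ)) '' Ici k) := ⟨c, hc, rfl⟩
  rw [LinearMap.image_convexHull] at h
  refine convexHull_min ?_ hC h
  rintro _ ⟨_, ⟨n, hn, rfl⟩, rfl⟩
  simpa using hu n hn

lemma aux_coe {α E : Type*} [MeasurableSpace α] {μ : Measure α} [NormedAddCommGroup E]
    [NormedSpace ℝ E] {p : ENNReal} (f : ℕ → Lp E p μ) (c : ℕ →₀ ℝ) :
    ∀ᵐ t ∂μ, (Finsupp.linearCombination ℝ f c : Lp E p μ) t =
      Finsupp.linearCombination ℝ (fun n => f n t) c := by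
  have h1 : ∀ᵐ t ∂μ, ∀ n, (c n • f n : Lp E p μ) t = c n • f n t :=
    ae_all_iff.2 fun n => Lp.coeFn_smul (c n) (f n)
  have h2 := Lp.coeFn_finsetSum c.support (fun n => c n • f n)
  filter_upwards [h1, h2] with t ht1 ht2
  simp only [Finsupp.linearCombination_apply, Finsupp.sum]
  rw [ht2]
  simp [ht1]

lemma aux_core {α X H : Type*} [MeasurableSpace α] {μ : Measure α} [IsFiniteMeasure μ]
    [NormedAddCommGroup X] [NormedSpace ℝ X]
    [NormedAddCommGroup H] [InnerProductSpace ℝ H] [CompleteSpace H]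
    (v : ℕ → H) (hv : Orthonormal ℝ v) (g : ℕ → Lp X 1 μ) (φ : α → ℝ) (hφ : Integrable φ μ)
    (hbound : ∀ᵐ t ∂μ, ∀ n, ‖g n t‖ ≤ |φ t|) (K : α → Set X)
    (hK : ∀ᵐ t ∂μ, IsCompact (K t) ∧ Convex ℝ (K t))
    (hgK : ∀ᵐ t ∂μ, ∀ ε > 0, ∀ᶠ n in atTop, g n t ∈ Metric.thickening ε (K t)) :
    ∃ (G : Lp X 1 μ) (c : ℕ → (ℕ →₀ ℝ)),
      (∀ k, c k ∈ convexHull ℝ ((fun n => Finsupp.single n (1 : ℝ)) '' Ici k)) ∧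
      (∀ᵐ t ∂μ, G t ∈ K t) ∧
      Tendsto (fun k => Finsupp.linearCombination ℝ g (c k)) atTop (nhds G) := by
  obtain ⟨T, hT⟩ := aux_embed v hv (⋃ n, range (g n))
    (.iUnion fun n => (Lp.stronglyMeasurable (g n)).isSeparable_range)
  set M := (Submodule.span ℝ (⋃ n, range (g n))).topologicalClosure
  have hM : IsClosed (M : Set X) := Submodule.isClosed_topologicalClosure _
  have hgM : ∀ n t, g n t ∈ M := fun n t =>
    Submodule.le_topologicalClosure _ (Submodule.subset_span (mem_iUnion.2 ⟨n, t, rfl⟩))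
  let w : α → ℝ := fun t => (1 + |φ t|)⁻¹
  have hw : ∀ t, 0 < w t := fun t => by positivity
  let U : ℕ → α → H := fun n t => w t • T (g n t)
  have hUm : ∀ n, AEStronglyMeasurable (U n) μ := by
    intro n
    have h1 : AEMeasurable w μ := (aemeasurable_const.add hφ.1.aemeasurable.abs).inv
    exact h1.aestronglyMeasurable.smul
      (T.continuous.comp_aestronglyMeasurable (Lp.aestronglyMeasurable (g n)))
  have hUb : ∀ n, ∀ᵐ t ∂μ, ‖U n t‖ ≤ ‖T‖ := by
    intro n
    filter_upwards [hbound] with t ht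
    have h1 := T.le_opNorm (g n t)
    simp only [U, norm_smul, Real.norm_eq_abs, abs_of_pos (hw t), w]
    rw [inv_mul_le_iff₀ (by positivity)]
    nlinarith [ht n, norm_nonneg T, mul_le_mul_of_nonneg_left (ht n) (norm_nonneg T)]
  have hUL : ∀ n, MemLp (U n) 2 μ := fun n => MemLp.of_bound (hUm n) _ (hUb n)
  let u : ℕ → Lp H 2 μ := fun n => (hUL n).toLp (U n)
  have hu : ∀ᵐ t ∂μ, ∀ n, u n t = U n t := ae_all_iff.2 fun n => (hUL n).coeFn_toLp
  obtain ⟨c, hc, hcau⟩ := aux_hilbert u _ (fun n => Lp.norm_le_of_ae_bound (norm_nonneg T) (by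
    filter_upwards [hUb n, hu] with t h1 h2
    rw [h2]; exact h1))
  obtain ⟨u', hu'⟩ := cauchySeq_tendsto_of_complete hcau
  obtain ⟨ns, hns, hae⟩ := (tendstoInMeasure_of_tendsto_Lp hu').exists_seq_tendsto_ae
  have hcu : ∀ᵐ t ∂μ, ∀ k, (Finsupp.linearCombination ℝ u (c k) : Lp H 2 μ) t =
      Finsupp.linearCombination ℝ (fun n => u n t) (c k) := ae_all_iff.2 fun k => aux_coe u (c k)
  have hcg : ∀ᵐ t ∂μ, ∀ k, (Finsupp.linearCombination ℝ g (c k) : Lp X 1 μ) t =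
      Finsupp.linearCombination ℝ (fun n => g n t) (c k) := ae_all_iff.2 fun k => aux_coe g (c k)
  let h : ℕ → Lp X 1 μ := fun k => Finsupp.linearCombination ℝ g (c (ns k))
  have hex : ∀ᵐ t ∂μ, ∃ a, a ∈ K t ∧ Tendsto (fun k => h k t) atTop (nhds a) := by
    filter_upwards [hu, hae, hcu, hcg, hK, hgK] with t hu hae hcu hcg hK hgK
    refine aux_conv T M hM hT (K t) hK.1 _ (fun k => ?_) (fun ε hε => ?_) ((w t)⁻¹ • u' t) ?_
    · simp only [h]
      rw [hcg]
      exact aux_hull _ _ _ (hc _) _ M.convex (fun n _ => hgM n t)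
    · obtain ⟨N, hN⟩ := eventually_atTop.1 (hgK ε hε)
      filter_upwards [eventually_ge_atTop N] with k hk
      simp only [h]
      rw [hcg]
      exact aux_hull _ _ _ (hc _) _ (hK.2.thickening ε)
        (fun n hn => hN n (hk.trans ((hns.id_le k).trans hn)))
    · have h1 := hae.const_smul (w t)⁻¹
      refine h1.congr fun k => ?_
      simp only [h]
      rw [hcu, hcg]
      simp only [Finsupp.linearCombination_apply, Finsupp.sum, hu, U, map_sum, map_smul,
        Finset.smul_sum]
      refine Finset.sum_congr rfl fun n _ => ?_
      rw [smul_comm (c (ns k) n) (w t), inv_smul_smul₀ (hw t).ne']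
  let Q : α → X → Prop := fun t a => a ∈ K t ∧ Tendsto (fun k => h k t) atTop (nhds a)
  let G : α → X := fun t => Classical.epsilon (Q t)
  have hG : ∀ᵐ t ∂μ, G t ∈ K t ∧ Tendsto (fun k => h k t) atTop (nhds (G t)) := by
    filter_upwards [hex] with t ht
    exact Classical.epsilon_spec (p := Q t) ht
  have hGlim : ∀ᵐ t ∂μ, Tendsto (fun k => h k t) atTop (nhds (G t)) := hG.mono fun t h => h.2
  have hhb : ∀ᵐ t ∂μ, ∀ k, ‖h k t‖ ≤ |φ t| := by
    filter_upwards [hbound, hcg] with t h1 h2 k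
    simp only [h]
    rw [h2, ← mem_closedBall_zero_iff]
    exact aux_hull _ _ _ (hc _) _ (convex_closedBall _ _)
      (fun n _ => mem_closedBall_zero_iff.2 (h1 n))
  have hGm : AEStronglyMeasurable G μ :=
    aestronglyMeasurable_of_tendsto_ae atTop (fun k => Lp.aestronglyMeasurable (h k)) hGlim
  have hGb : ∀ᵐ t ∂μ, ‖G t‖ ≤ |φ t| := by
    filter_upwards [hGlim, hhb] with t h1 h2
    exact le_of_tendsto' h1.norm h2
  have hGL : MemLp G 1 μ := memLp_one_iff_integrable.2 (hφ.abs.mono' hGm hGb)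
  refine ⟨hGL.toLp G, fun k => c (ns k), fun k => ?_, ?_, ?_⟩
  · exact convexHull_mono (image_mono (Ici_subset_Ici.2 (hns.id_le k))) (hc (ns k))
  · filter_upwards [hG, hGL.coeFn_toLp] with t h1 h2
    rw [h2]
    exact h1.1
  · rw [Lp.tendsto_Lp_iff_tendsto_eLpNorm]
    have := tendsto_lintegral_norm_of_dominated_convergence
      (fun k => Lp.aestronglyMeasurable (h k)) hφ.abs.2 (fun k => hhb.mono fun t ht => ht k) hGlim
    refine this.congr fun k => ?_
    rw [eLpNorm_one_eq_lintegral_enorm]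
    simp [h]

/-- **Lemma 3.2 (closed-graph lemma for `Λ ∘ S_F`).**
Let `F : J × X → P_{cp,cv}(X)` be an `L¹`-Carathéodory multivalued map with nonempty
selection sets `S_{F,y}`, and let `Λ : L¹(J,X) → C(J,X)` be a continuous linear operator.
If `y_n → y` in `C(J,X)`, `z_n ∈ Λ(S_{F,y_n})` and `z_n → z` in `C(J,X)`, then
`z ∈ Λ(S_{F,y})`. -/
theorem stmt8 {X : Type*} [NormedAddCommGroup X] [NormedSpace ℝ X]
    (b : ℝ) (hb : 0 < b)
    (F : ℝ → X → Set X)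
    (hval : ∀ t ∈ Set.Icc (0 : ℝ) b, ∀ x : X,
      (F t x).Nonempty ∧ IsCompact (F t x) ∧ Convex ℝ (F t x))
    (hmeas : ∀ x : X, ∀ C : Set X, IsClosed C →
      MeasurableSet {t : ℝ | t ∈ Set.Icc (0 : ℝ) b ∧ (F t x ∩ C).Nonempty})
    (husc : ∀ᵐ t ∂(volume.restrict (Set.Icc (0 : ℝ) b)),
      ∀ x : X, ∀ W : Set X, IsOpen W → F t x ⊆ W → ∀ᶠ y in nhds x, F t y ⊆ W)
    (hgrowth : ∀ r : ℝ, 0 < r → ∃ φ : ℝ → ℝ,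
      IntegrableOn φ (Set.Icc (0 : ℝ) b) ∧
      ∀ᵐ t ∂(volume.restrict (Set.Icc (0 : ℝ) b)),
        ∀ x : X, ‖x‖ ≤ r → ∀ v ∈ F t x, ‖v‖ ≤ φ t)
    (hSF : ∀ y : C(Set.Icc (0 : ℝ) b, X),
      ∃ g : Lp X 1 (volume.restrict (Set.Icc (0 : ℝ) b)),
        ∀ᵐ t ∂(volume.restrict (Set.Icc (0 : ℝ) b)),
          ∀ ht : t ∈ Set.Icc (0 : ℝ) b, (g : ℝ → X) t ∈ F t (y ⟨t, ht⟩))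
    (Λ : Lp X 1 (volume.restrict (Set.Icc (0 : ℝ) b)) →L[ℝ] C(Set.Icc (0 : ℝ) b, X))
    (yn : ℕ → C(Set.Icc (0 : ℝ) b, X)) (y : C(Set.Icc (0 : ℝ) b, X))
    (zn : ℕ → C(Set.Icc (0 : ℝ) b, X)) (z : C(Set.Icc (0 : ℝ) b, X))
    (hy : Tendsto yn atTop (nhds y))
    (hmem : ∀ n : ℕ, ∃ g : Lp X 1 (volume.restrict (Set.Icc (0 : ℝ) b)),
      (∀ᵐ t ∂(volume.restrict (Set.Icc (0 : ℝ) b)),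
        ∀ ht : t ∈ Set.Icc (0 : ℝ) b, (g : ℝ → X) t ∈ F t (yn n ⟨t, ht⟩)) ∧
      zn n = Λ g)
    (hz : Tendsto zn atTop (nhds z)) :
    ∃ g : Lp X 1 (volume.restrict (Set.Icc (0 : ℝ) b)),
      (∀ᵐ t ∂(volume.restrict (Set.Icc (0 : ℝ) b)),
        ∀ ht : t ∈ Set.Icc (0 : ℝ) b, (g : ℝ → X) t ∈ F t (y ⟨t, ht⟩)) ∧
      z = Λ g := by
  choose g hg hgz using hmem
  obtain ⟨r, hr0, hr⟩ : ∃ r : ℝ, 0 < r ∧ ∀ n, ‖yn n‖ ≤ r := by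
    obtain ⟨R, hR⟩ := hy.norm.bddAbove_range
    exact ⟨max R 1, by positivity, fun n => (hR ⟨n, rfl⟩).trans (le_max_left _ _)⟩
  obtain ⟨φ, hφ, hφb⟩ := hgrowth r hr0
  have hIcc : ∀ᵐ t ∂(volume.restrict (Set.Icc (0 : ℝ) b)), t ∈ Set.Icc (0 : ℝ) b :=
    ae_restrict_mem measurableSet_Icc
  have hgall := ae_all_iff.2 hg
  have hv : Orthonormal ℝ (fun n => (HilbertBasis.ofRepr
    (LinearIsometryEquiv.refl ℝ (lp (fun _ : ℕ => ℝ) 2))) n) := HilbertBasis.orthonormal _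
  have hproj : ∀ t (ht : t ∈ Set.Icc (0 : ℝ) b), Set.projIcc 0 b hb.le t = ⟨t, ht⟩ :=
    fun t ht => Set.projIcc_of_mem hb.le ht
  obtain ⟨G, c, hc, hGK, hlim⟩ := aux_core _ hv g φ hφ
    (by
      filter_upwards [hIcc, hgall, hφb] with t ht hgt hφt n
      exact (hφt _ (((yn n).norm_coe_le_norm _).trans (hr n)) _ (hgt n ht)).trans (le_abs_self _))
    (fun t => F t (y (Set.projIcc 0 b hb.le t)))
    (by
      filter_upwards [hIcc] with t ht
      exact (hval t ht _).2)
    (by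
      filter_upwards [hIcc, hgall, husc] with t ht hgt hut ε hε
      have h1 := hut _ _ Metric.isOpen_thickening
        (Metric.self_subset_thickening hε (F t (y (Set.projIcc 0 b hb.le t))))
      have h2 : Tendsto (fun n => yn n (Set.projIcc 0 b hb.le t)) atTop
          (nhds (y (Set.projIcc 0 b hb.le t))) :=
        ((continuous_eval_const (Set.projIcc 0 b hb.le t)).tendsto y).comp hy
      filter_upwards [h2.eventually h1] with n hn
      apply hn
      rw [hproj t ht]
      exact hgt n ht)
  refine ⟨G, ?_, ?_⟩
  · filter_upwards [hGK] with t h1 ht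
    rw [← hproj t ht]
    exact h1
  · refine tendsto_nhds_unique ?_ ((Λ.continuous.tendsto G).comp hlim)
    rw [Metric.tendsto_atTop] at hz ⊢
    intro ε hε
    obtain ⟨N, hN⟩ := hz ε hε
    refine ⟨N, fun k hk => ?_⟩
    have h1 : Λ (Finsupp.linearCombination ℝ g (c k)) =
        Finsupp.linearCombination ℝ zn (c k) := by
      simp [Finsupp.linearCombination_apply, Finsupp.sum, hgz]
    rw [Function.comp_apply, h1]
    exact aux_hull zn k _ (hc k) (Metric.ball z ε) (convex_ball _ _)
      (fun n hn => hN n (hk.trans hn))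
end

section
/- Let D be a nonempty bounded, closed, convex subset of a Banach space X and let V : D → 2^X \ {∅} be an upper semicontinuous, condensing multivalued map such that for every x ∈ D the set V(x) is a closed convex subset of D. Then V has a fixed point: there exists x ∈ D with x ∈ V(x). -/
noncomputable section

/-- The Kuratowski measure of noncompactness:
`κ(S) = inf {d > 0 : S can be covered by finitely many sets of diameter ≤ d}`. -/
def kuratowski {X : Type*} [PseudoEMetricSpace X] (S : Set X) : ℝ :=
  sInf {d : ℝ | 0 < d ∧ ∃ 𝒞 : Finset (Set X),
    (S ⊆ ⋃ A ∈ 𝒞, A) ∧ ∀ A ∈ 𝒞, EMetric.diam A ≤ ENNReal.ofReal d}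


lemma two_fiber {A B : Type*} [DecidableEq A] [DecidableEq B] (f : A → B) (s : Finset A)
    (t : Finset B) (hst : s.image f = t) (hc : s.card = t.card + 1) :
    ∃ a ∈ s, ∃ b ∈ s, a ≠ b ∧ f a = f b ∧ ∀ x ∈ s, ∀ y ∈ s, f x = f y →
      x = y ∨ (x = a ∧ y = b) ∨ (x = b ∧ y = a) := by
  have hni : ¬ Set.InjOn f (s : Set A) := by
    intro h
    have := Finset.card_image_of_injOn h
    rw [hst] at this
    omega
  simp only [Set.InjOn, not_forall] at hni
  obtain ⟨a, ha, b, hb, hab, hne⟩ := hni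
  refine ⟨a, ha, b, hb, hne, hab, ?_⟩
  have him : (s.erase a).image f = t := by
    rw [← hst]
    ext y
    simp only [Finset.mem_image, Finset.mem_erase]
    constructor
    · rintro ⟨x, ⟨_, hx⟩, rfl⟩
      exact ⟨x, hx, rfl⟩
    · rintro ⟨x, hx, rfl⟩
      by_cases hxa : x = a
      · subst hxa
        exact ⟨b, ⟨fun h => hne h.symm, hb⟩, hab.symm⟩
      · exact ⟨x, ⟨hxa, hx⟩, rfl⟩
  have hinj : Set.InjOn f (s.erase a : Finset A) := by
    apply Finset.card_image_iff.mp
    rw [him, Finset.card_erase_of_mem ha]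
    omega
  have key : ∀ x ∈ s, x ≠ a → ∀ y ∈ s, y ≠ a → f x = f y → x = y := by
    intro x hx hxa y hy hya h
    exact hinj (by simp [hx, hxa]) (by simp [hy, hya]) h
  intro x hx y hy h
  by_cases hxa : x = a <;> by_cases hya : y = a
  · left; rw [hxa, hya]
  · right; left
    exact ⟨hxa, key y hy hya b hb (Ne.symm hne) (by rw [← h, hxa, hab])⟩
  · right; right
    exact ⟨key x hx hxa b hb (Ne.symm hne) (by rw [h, hya, hab]), hya⟩
  · left; exact key x hx hxa y hy hya h

def ScarfDom {I U : Type*} (r : I → U → ℕ) (S : Finset U) : Prop :=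
  ∀ y, ∃ i, ∀ x ∈ S, r i y ≤ r i x

def ScarfTop {I U : Type*} (r : I → U → ℕ) (m : I → U) (a : I) (x : U) : Prop :=
  (∀ i, i ≠ a → r i (m i) < r i x) ∧
    ∀ y, (∀ i, i ≠ a → r i (m i) < r i y) → r a y ≤ r a x

lemma ScarfTop.exists {I U : Type*} [Fintype U] (r : I → U → ℕ) (m : I → U) (a : I) (x : U)
    (hx : ∀ i, i ≠ a → r i (m i) < r i x) : ∃ y, ScarfTop r m a y := by
  classical
  obtain ⟨y, hy, hy2⟩ := Finset.exists_max_image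
    (Finset.univ.filter fun z => ∀ i, i ≠ a → r i (m i) < r i z) (r a) ⟨x, by simpa using hx⟩
  refine ⟨y, by simpa using hy, fun z hz => hy2 z (by simpa using hz)⟩

section
variable {I U : Type*} [Fintype I] [DecidableEq I] [Fintype U] [DecidableEq U]
  (r : I → U → ℕ)

lemma ScarfTop.unique (hr : ∀ i, Function.Injective (r i))
    (m : I → U) (a : I) (x y : U) (hx : ScarfTop r m a x) (hy : ScarfTop r m a y) :
    x = y := hr a (le_antisymm (hy.2 x hx.1) (hx.2 y hy.1))

lemma ScarfTop.dom (hr : ∀ i, Function.Injective (r i))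
    (τ : Finset U) (hd : ScarfDom r τ) (m : I → U) (hm : ∀ i, m i ∈ τ)
    (hmin : ∀ i, ∀ x ∈ τ, r i (m i) ≤ r i x) (a b : I) (hab : a ≠ b) (hmab : m a = m b)
    (x : U) (hx : ScarfTop r m a x) :
    x ∉ τ ∧ ScarfDom r (insert x τ) ∧ r a x < r a (m a) := by
  have h1 : ∀ z ∈ τ, r a x ≤ r a z := by
    obtain ⟨i, hi⟩ := hd x
    by_cases hia : i = a
    · subst hia; exact hi
    · have := hx.1 i hia
      have := hi _ (hm i)
      omega
  have hxτ : x ∉ τ := by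
    intro hxt
    have h2 : x = m a := hr a (le_antisymm (h1 _ (hm a)) (hmin a x hxt))
    have := hx.1 b hab.symm
    rw [h2, hmab] at this
    omega
  refine ⟨hxτ, ?_, ?_⟩
  · intro y
    by_cases hy : ∀ i, i ≠ a → r i (m i) < r i y
    · refine ⟨a, ?_⟩
      have h3 := hx.2 y hy
      intro z hz
      rcases Finset.mem_insert.mp hz with rfl | hz
      · exact h3
      · exact h3.trans (h1 z hz)
    · push Not at hy
      obtain ⟨i, hia, hi⟩ := hy
      refine ⟨i, ?_⟩
      intro z hz
      rcases Finset.mem_insert.mp hz with rfl | hz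
      · exact hi.trans (hx.1 i hia).le
      · exact hi.trans (hmin i z hz)
  · refine lt_of_le_of_ne (h1 _ (hm a)) ?_
    intro h
    exact hxτ (hr a h ▸ hm a)

lemma scarfTop_of_dom (hr : ∀ i, Function.Injective (r i))
    (τ : Finset U) (m : I → U) (hm : ∀ i, m i ∈ τ)
    (hmin : ∀ i, ∀ x ∈ τ, r i (m i) ≤ r i x) (a b : I)
    (hf : ∀ x y, m x = m y → x = y ∨ (x = a ∧ y = b) ∨ (x = b ∧ y = a))
    (x : U) (hxτ : x ∉ τ) (hd : ScarfDom r (insert x τ)) :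
    ScarfTop r m a x ∨ ScarfTop r m b x := by
  obtain ⟨k, hk⟩ := hd x
  have hk' : r k x < r k (m k) := by
    refine lt_of_le_of_ne (hk _ (by simp [hm])) ?_
    intro h
    exact hxτ (hr k h ▸ hm k)
  have good : ∀ i, ∃ j, m j = m i ∧ r j (m j) < r j x := by
    intro i
    obtain ⟨j, hj⟩ := hd (m i)
    have h1 : m j = m i := hr j (le_antisymm (hmin j _ (hm i)) (hj _ (by simp [hm])))
    refine ⟨j, h1, ?_⟩
    rw [h1]
    refine lt_of_le_of_ne (hj _ (by simp)) ?_
    intro h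
    exact hxτ (hr j h ▸ hm i)
  have hall : ∀ i, i ≠ k → r i (m i) < r i x := by
    intro i hik
    obtain ⟨j, hj, hj2⟩ := good i
    obtain ⟨l, hl, hl2⟩ := good k
    have hjk : j ≠ k := by rintro rfl; omega
    have hlk : l ≠ k := by rintro rfl; omega
    have h1 := hf _ _ hj
    have h2 := hf _ _ hl
    have : j = i := by grind
    rwa [this] at hj2
  have htop : ScarfTop r m k x := by
    refine ⟨hall, ?_⟩
    intro y hy
    obtain ⟨i, hi⟩ := hd y
    by_cases hik : i = k
    · subst hik; exact hi x (by simp)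
    · have := hy i hik
      have := hi (m i) (by simp [hm])
      omega
  obtain ⟨l, hl, hl2⟩ := good k
  have hlk : l ≠ k := by rintro rfl; omega
  rcases hf _ _ hl with h | ⟨_, h⟩ | ⟨_, h⟩
  · exact absurd h hlk
  · right; rwa [← h]
  · left; rwa [← h]

open Classical in
lemma door_structure (hr : ∀ i, Function.Injective (r i))
    [Nontrivial I] (τ : Finset U) (hd : ScarfDom r τ)
    (hc : τ.card + 1 = Fintype.card I) :
    ∃ (m : I → U) (a b : I), (∀ i, m i ∈ τ) ∧ (∀ i, ∀ x ∈ τ, r i (m i) ≤ r i x) ∧ a ≠ b ∧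
      m a = m b ∧ (∀ x y, m x = m y → x = y ∨ (x = a ∧ y = b) ∨ (x = b ∧ y = a)) ∧
      ∀ S : Finset U, (ScarfDom r S ∧ S.card = Fintype.card I ∧ τ ⊆ S) ↔
        ∃ x, S = insert x τ ∧ (ScarfTop r m a x ∨ ScarfTop r m b x) := by
  have hne : τ.Nonempty := by
    have := Fintype.one_lt_card (α := I)
    rw [← Finset.card_pos]; omega
  choose m hm hmin using fun i => Finset.exists_min_image τ (r i) hne
  have him : Finset.univ.image m = τ := by
    ext y
    simp only [Finset.mem_image, Finset.mem_univ, true_and]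
    constructor
    · rintro ⟨i, rfl⟩; exact hm i
    · intro hy
      obtain ⟨i, hi⟩ := hd y
      exact ⟨i, hr i (le_antisymm (hmin i y hy) (hi _ (hm i)))⟩
  obtain ⟨a, -, b, -, hab, hmab, hf⟩ := two_fiber m Finset.univ τ him (by simp [hc])
  have hf' : ∀ x y, m x = m y → x = y ∨ (x = a ∧ y = b) ∨ (x = b ∧ y = a) :=
    fun x y h => hf x (by simp) y (by simp) h
  refine ⟨m, a, b, hm, hmin, hab, hmab, hf', ?_⟩
  intro S
  constructor
  · rintro ⟨hS, hSc, hsub⟩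
    have : (S \ τ).card = 1 := by rw [Finset.card_sdiff_of_subset hsub]; omega
    obtain ⟨x, hx⟩ := Finset.card_eq_one.mp this
    have hxm : x ∈ S \ τ := by simp [hx]
    have hSx : S = insert x τ := by
      rw [← Finset.sdiff_union_of_subset hsub, hx]; rfl
    refine ⟨x, hSx, ?_⟩
    subst hSx
    exact scarfTop_of_dom r hr τ m hm hmin a b hf' x (Finset.mem_sdiff.mp hxm).2 hS
  · rintro ⟨x, rfl, h⟩
    have : x ∉ τ ∧ ScarfDom r (insert x τ) := by
      rcases h with h | h
      · have := ScarfTop.dom r hr τ hd m hm hmin a b hab hmab x h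
        exact ⟨this.1, this.2.1⟩
      · have := ScarfTop.dom r hr τ hd m hm hmin b a hab.symm hmab.symm x h
        exact ⟨this.1, this.2.1⟩
    refine ⟨this.2, ?_, Finset.subset_insert _ _⟩
    rw [Finset.card_insert_of_notMem this.1, hc]

open Classical in
lemma door_two (hr : ∀ i, Function.Injective (r i))
    (e : I → U)
    (he2 : ∀ i j, i ≠ j → ∀ x, (∀ k, x ≠ e k) → r i x < r i (e j))
    [Nontrivial I] (τ : Finset U) (hd : ScarfDom r τ)
    (hc : τ.card + 1 = Fintype.card I) (t : U) (ht : t ∈ τ) (hte : ∀ k, t ≠ e k) :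
    (Finset.univ.filter fun S : Finset U =>
      ScarfDom r S ∧ S.card = Fintype.card I ∧ τ ⊆ S).card = 2 := by
  obtain ⟨m, a, b, hm, hmin, hab, hmab, hf, h⟩ := door_structure r hr τ hd hc
  have ex : ∀ a, ∃ x, ScarfTop r m a x := by
    intro a
    apply ScarfTop.exists r m a (e a)
    intro i hi
    exact (hmin i t ht).trans_lt (he2 i a hi t hte)
  obtain ⟨x, hx⟩ := ex a
  obtain ⟨y, hy⟩ := ex b
  have hx' := ScarfTop.dom r hr τ hd m hm hmin a b hab hmab x hx
  have hy' := ScarfTop.dom r hr τ hd m hm hmin b a hab.symm hmab.symm y hy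
  rw [Finset.card_eq_two]
  refine ⟨insert x τ, insert y τ, ?_, ?_⟩
  · intro heq
    have hxy : x = y := by
      have : x ∈ insert y τ := by rw [← heq]; simp
      rcases Finset.mem_insert.mp this with h | h
      · exact h
      · exact absurd h hx'.1
    subst hxy
    have := hx.1 b hab.symm
    have := hy'.2.2
    omega
  · ext S
    simp only [Finset.mem_filter, Finset.mem_univ, true_and, Finset.mem_insert,
      Finset.mem_singleton, h]
    constructor
    · rintro ⟨z, rfl, hz | hz⟩
      · left; rw [ScarfTop.unique r hr m a z x hz hx]
      · right; rw [ScarfTop.unique r hr m b z y hz hy]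
    · rintro (rfl | rfl)
      · exact ⟨x, rfl, Or.inl hx⟩
      · exact ⟨y, rfl, Or.inr hy⟩

open Classical in
lemma door_one (hr : ∀ i, Function.Injective (r i))
    (e : I → U)
    (he : ∀ i x, x ≠ e i → r i (e i) < r i x)
    (he2 : ∀ i j, i ≠ j → ∀ x, (∀ k, x ≠ e k) → r i x < r i (e j))
    [Nontrivial I] (k : I) (he0 : Function.Injective e) :
    ScarfDom r ((Finset.univ.erase k).image e) ∧
    (Finset.univ.filter fun S : Finset U =>
      ScarfDom r S ∧ S.card = Fintype.card I ∧ (Finset.univ.erase k).image e ⊆ S).card = 1 := by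
  have hd : ScarfDom r ((Finset.univ.erase k).image e) := by
    intro y
    by_cases hy : ∃ j, y = e j
    · obtain ⟨j, rfl⟩ := hy
      refine ⟨j, fun x _ => ?_⟩
      by_cases hx : x = e j
      · rw [hx]
      · exact (he j x hx).le
    · push Not at hy
      refine ⟨k, fun x hx => ?_⟩
      simp only [Finset.mem_image, Finset.mem_erase, Finset.mem_univ, and_true] at hx
      obtain ⟨j, hj, rfl⟩ := hx
      exact (he2 k j hj.symm y hy).le
  refine ⟨hd, ?_⟩
  have hc : ((Finset.univ.erase k).image e).card + 1 = Fintype.card I := by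
    rw [Finset.card_image_of_injective _ he0, Finset.card_erase_of_mem (Finset.mem_univ k),
      Finset.card_univ]
    have := Fintype.card_pos (α := I)
    omega
  obtain ⟨m, a, b, hm, hmin, hab, hmab, hf, h⟩ := door_structure r hr _ hd hc
  have hmj : ∀ j, j ≠ k → m j = e j := by
    intro j hj
    by_contra hne
    have h1 := he j _ hne
    have h2 := hmin j (e j) (by simp only [Finset.mem_image]; exact ⟨j, by simp [hj], rfl⟩)
    omega
  obtain ⟨j, hj, hjm⟩ : ∃ j, j ≠ k ∧ e j = m k := by
    have := hm k
    simpa using this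
  have hnone : ∀ x, ¬ ScarfTop r m j x := by
    intro x hx
    have h1 := hx.1 k hj.symm
    rw [← hjm] at h1
    by_cases hxe : ∃ i, x = e i
    · obtain ⟨i, rfl⟩ := hxe
      by_cases hij : i = j
      · subst hij; omega
      · have h2 := hx.1 i hij
        by_cases hik : i = k
        · subst hik
          have := he i (e j) (fun h => hj (he0 h))
          omega
        · rw [hmj i hik] at h2; omega
    · push Not at hxe
      have := he2 k j hj.symm x hxe
      omega
  obtain ⟨x, hx⟩ : ∃ x, ScarfTop r m k x := by
    apply ScarfTop.exists r m k (e k)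
    intro i hi
    rw [hmj i hi]
    exact he i _ (fun h => hi (he0 h).symm)
  have hcase : (k = a ∧ j = b) ∨ (k = b ∧ j = a) := by
    rcases hf k j (by rw [hmj j hj, hjm]) with h | h | h
    · exact absurd h.symm hj
    · exact Or.inl h
    · exact Or.inr h
  rw [Finset.card_eq_one]
  refine ⟨insert x ((Finset.univ.erase k).image e), ?_⟩
  ext S
  simp only [Finset.mem_filter, Finset.mem_univ, true_and, Finset.mem_singleton, h]
  have hor : ∀ z, (ScarfTop r m a z ∨ ScarfTop r m b z) ↔ ScarfTop r m k z := by
    intro z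
    rcases hcase with ⟨rfl, rfl⟩ | ⟨rfl, rfl⟩ <;> simp [hnone]
  simp only [hor]
  constructor
  · rintro ⟨z, rfl, hz⟩
    rw [ScarfTop.unique r hr m k z x hz hx]
  · rintro rfl
    exact ⟨x, rfl, hx⟩

open Classical in
lemma room_even [Nontrivial I] (c : U → I) (k : I) (S : Finset U) (hS : ScarfDom r S)
    (hc : S.card = Fintype.card I) (hne : S.image c ≠ Finset.univ) :
    Even (Finset.univ.filter fun τ : Finset U => (ScarfDom r τ ∧ τ.card + 1 = Fintype.card I ∧
      τ.image c = Finset.univ.erase k) ∧ τ ⊆ S).card := by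
  rcases Finset.eq_empty_or_nonempty (Finset.univ.filter fun τ : Finset U => (ScarfDom r τ ∧
    τ.card + 1 = Fintype.card I ∧ τ.image c = Finset.univ.erase k) ∧ τ ⊆ S) with h | ⟨τ, hτ⟩
  · rw [h]; simp
  simp only [Finset.mem_filter, Finset.mem_univ, true_and] at hτ
  obtain ⟨⟨hτd, hτc, hτi⟩, hsub⟩ := hτ
  have hSi : S.image c = Finset.univ.erase k := by
    have h1 : Finset.univ.erase k ⊆ S.image c := by
      rw [← hτi]; exact Finset.image_subset_image hsub
    apply Finset.Subset.antisymm _ h1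
    intro x hx
    simp only [Finset.mem_erase, Finset.mem_univ, and_true]
    rintro rfl
    apply hne
    ext y
    simp only [Finset.mem_univ, iff_true]
    by_cases hy : y = x
    · rwa [hy]
    · exact h1 (by simp [hy])
  have hpos := Fintype.card_pos (α := I)
  obtain ⟨a, ha, b, hb, hab, hcab, hf⟩ := two_fiber c S _ hSi (by
    rw [Finset.card_erase_of_mem (Finset.mem_univ k), hc, Finset.card_univ]; omega)
  have : (Finset.univ.filter fun τ : Finset U => (ScarfDom r τ ∧ τ.card + 1 = Fintype.card I ∧
      τ.image c = Finset.univ.erase k) ∧ τ ⊆ S) = {S.erase a, S.erase b} := by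
    ext ρ
    simp only [Finset.mem_filter, Finset.mem_univ, true_and, Finset.mem_insert,
      Finset.mem_singleton]
    have back : ∀ a ∈ S, ∀ b ∈ S, a ≠ b → c a = c b → (ScarfDom r (S.erase a) ∧
        (S.erase a).card + 1 = Fintype.card I ∧
        (S.erase a).image c = Finset.univ.erase k) ∧ S.erase a ⊆ S := by
      intro a ha b hb hab hcab
      refine ⟨⟨?_, ?_, ?_⟩, Finset.erase_subset _ _⟩
      · intro y
        obtain ⟨i, hi⟩ := hS y
        exact ⟨i, fun x hx => hi x (Finset.mem_of_mem_erase hx)⟩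
      · rw [Finset.card_erase_of_mem ha]; omega
      · rw [← hSi]
        apply Finset.Subset.antisymm (Finset.image_subset_image (Finset.erase_subset _ _))
        intro y hy
        obtain ⟨x, hx, rfl⟩ := Finset.mem_image.mp hy
        by_cases hxa : x = a
        · rw [hxa, hcab]
          exact Finset.mem_image_of_mem _ (by simp [hb, hab.symm])
        · exact Finset.mem_image_of_mem _ (by simp [hx, hxa])
    constructor
    · rintro ⟨⟨-, hρc, hρi⟩, hρS⟩
      have h1 : (S \ ρ).card = 1 := by rw [Finset.card_sdiff_of_subset hρS]; omega
      obtain ⟨x, hx⟩ := Finset.card_eq_one.mp h1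
      have hxm : x ∈ S ∧ x ∉ ρ := by rw [← Finset.mem_sdiff, hx]; simp
      have hρx : ρ = S.erase x := by
        rw [← Finset.sdiff_singleton_eq_erase, ← hx, Finset.sdiff_sdiff_eq_self hρS]
      have h2 : c x ∈ ρ.image c := by
        rw [hρi, ← hSi]; exact Finset.mem_image_of_mem _ hxm.1
      obtain ⟨y, hy, hyx⟩ := Finset.mem_image.mp h2
      rcases hf y (hρS hy) x hxm.1 hyx with h | ⟨_, h⟩ | ⟨_, h⟩
      · exact absurd (h ▸ hy) hxm.2
      · right; rw [hρx, h]
      · left; rw [hρx, h]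
    · rintro (rfl | rfl)
      · exact back a ha b hb hab hcab
      · exact back b hb a ha hab.symm hcab.symm
  rw [this, Finset.card_pair]
  · exact even_two
  · intro h
    have : a ∈ S.erase b := by simp [ha, hab]
    rw [← h] at this
    simp at this

open Classical in
lemma scarf (hr : ∀ i, Function.Injective (r i))
    (e : I → U)
    (he : ∀ i x, x ≠ e i → r i (e i) < r i x)
    (he2 : ∀ i j, i ≠ j → ∀ x, (∀ k, x ≠ e k) → r i x < r i (e j))
    [Nontrivial I] (c : U → I) (hce : ∀ i, c (e i) = i) :
    ∃ S : Finset U, ScarfDom r S ∧ S.card = Fintype.card I ∧ S.image c = Finset.univ := by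
  by_contra hcon
  push Not at hcon
  have he0 : Function.Injective e := fun i j h => by rw [← hce i, h, hce]
  obtain ⟨k⟩ : Nonempty I := inferInstance
  have key := Finset.sum_card_bipartiteAbove_eq_sum_card_bipartiteBelow
    (s := Finset.univ.filter fun S : Finset U => ScarfDom r S ∧ S.card = Fintype.card I)
    (t := Finset.univ.filter fun τ : Finset U => ScarfDom r τ ∧ τ.card + 1 = Fintype.card I ∧
      τ.image c = Finset.univ.erase k) (fun S τ => τ ⊆ S)
  simp only [Finset.bipartiteAbove, Finset.bipartiteBelow, Finset.filter_filter] at key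
  obtain ⟨hd, hone⟩ := door_one r hr e he he2 k he0
  have hmem : (Finset.univ.erase k).image e ∈ Finset.univ.filter fun τ : Finset U =>
      ScarfDom r τ ∧ τ.card + 1 = Fintype.card I ∧ τ.image c = Finset.univ.erase k := by
    simp only [Finset.mem_filter, Finset.mem_univ, true_and]
    refine ⟨hd, ?_, ?_⟩
    · rw [Finset.card_image_of_injective _ he0, Finset.card_erase_of_mem (Finset.mem_univ k),
        Finset.card_univ]
      have := Fintype.card_pos (α := I)
      omega
    · rw [Finset.image_image]
      have : c ∘ e = id := funext hce
      rw [this, Finset.image_id]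
  rw [← Finset.add_sum_erase _ _ hmem] at key
  simp only [and_assoc] at key hone
  rw [hone] at key
  have hE1 : ∀ S ∈ (Finset.univ.filter fun S : Finset U => ScarfDom r S ∧ S.card = Fintype.card I),
      Even (Finset.univ.filter fun τ : Finset U => ScarfDom r τ ∧ τ.card + 1 = Fintype.card I ∧
      τ.image c = Finset.univ.erase k ∧ τ ⊆ S).card := by
    intro S hS
    simp only [Finset.mem_filter, Finset.mem_univ, true_and] at hS
    have := room_even r c k S hS.1 hS.2 (hcon S hS.1 hS.2)
    simpa only [and_assoc] using this
  have h1 := Finset.even_sum _ hE1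
  rw [key] at h1
  have h2 := Finset.even_sum (s := (Finset.univ.filter fun τ : Finset U =>
      ScarfDom r τ ∧ τ.card + 1 = Fintype.card I ∧ τ.image c = Finset.univ.erase k).erase
      ((Finset.univ.erase k).image e)) (f := fun τ => (Finset.univ.filter fun S : Finset U =>
      ScarfDom r S ∧ S.card = Fintype.card I ∧ τ ⊆ S).card) (by
    intro τ hτ
    simp only [Finset.mem_erase, Finset.mem_filter, Finset.mem_univ, true_and] at hτ
    obtain ⟨hne, hτd, hτc, hτi⟩ := hτ
    by_cases hall : ∃ t ∈ τ, ∀ k, t ≠ e k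
    · obtain ⟨t, ht, hte⟩ := hall
      rw [door_two r hr e he2 τ hτd hτc t ht hte]
      exact even_two
    · exfalso
      push Not at hall
      apply hne
      ext x
      have hx : x ∈ τ → ∃ j, j ≠ k ∧ e j = x := by
        intro hx
        obtain ⟨j, rfl⟩ := hall x hx
        have : c (e j) ∈ Finset.univ.erase k := by
          rw [← hτi]; exact Finset.mem_image_of_mem _ hx
        rw [hce] at this
        exact ⟨j, by simpa using this, rfl⟩
      simp only [Finset.mem_image, Finset.mem_erase, Finset.mem_univ, and_true]
      refine ⟨hx, ?_⟩
      rintro ⟨j, hj, rfl⟩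
      have : j ∈ τ.image c := by rw [hτi]; simp [hj]
      obtain ⟨y, hy, rfl⟩ := Finset.mem_image.mp this
      obtain ⟨i, rfl⟩ := hall y hy
      rwa [hce])
  rw [Nat.even_add] at h1
  simp only [h2, iff_true] at h1
  exact absurd h1 (by decide)

end

lemma exists_grid_above {I : Type*} [Fintype I] [DecidableEq I] (N : ℕ) (C : Finset I)
    (hC : C.Nonempty) (m : I → ℕ) (h : ∑ i ∈ C, (m i + 1) ≤ N) :
    ∃ y : I → Fin (N + 1), (∑ i, (y i : ℕ) = N) ∧ ∀ i ∈ C, m i < y i := by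
  obtain ⟨k, hk⟩ := hC
  let g : I → ℕ := fun i => (if i ∈ C then m i + 1 else 0) +
    (if i = k then N - ∑ i ∈ C, (m i + 1) else 0)
  have hg : ∑ i, g i = N := by
    simp only [g, Finset.sum_add_distrib, Finset.sum_ite_mem, Finset.univ_inter,
      Finset.sum_ite_eq', Finset.mem_univ, if_true]
    simp only [Finset.sum_add_distrib] at h
    omega
  have hle : ∀ i, g i < N + 1 := by
    intro i
    have := Finset.single_le_sum (f := g) (fun i _ => Nat.zero_le _) (Finset.mem_univ i)
    omega
  refine ⟨fun i => ⟨g i, hle i⟩, hg, ?_⟩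
  intro i hi
  simp only [g, hi, if_true]
  omega

open Classical in
lemma scarf_grid {I : Type*} [Fintype I] [Nontrivial I] (f : (I → ℝ) → (I → ℝ))
    (hf : Set.MapsTo f (stdSimplex ℝ I) (stdSimplex ℝ I)) (N : ℕ) (hN : 0 < N) :
    ∃ z ∈ stdSimplex ℝ I, ∀ i, z i ≤ (Fintype.card I : ℝ) / N ∨ ∃ x ∈ stdSimplex ℝ I,
      (∀ j, |x j - z j| ≤ (Fintype.card I : ℝ) / N) ∧ x i ≤ f x i := by
  let T := {x : I → Fin (N + 1) // ∑ i, (x i : ℕ) = N}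
  let p : T → I → ℝ := fun x i => ((x.1 i : ℕ) : ℝ) / N
  have hN' : (0 : ℝ) < N := by exact_mod_cast hN
  have hp : ∀ x, p x ∈ stdSimplex ℝ I := by
    intro x
    refine ⟨fun i => by positivity, ?_⟩
    simp only [p]
    rw [← Finset.sum_div, ← Nat.cast_sum, x.2]
    field_simp
  let M := Fintype.card T
  let idx := Fintype.equivFin T
  let idI := Fintype.equivFin I
  let r : I → T ⊕ I → ℕ := fun i u => match u with
    | Sum.inl x => (x.1 i : ℕ) * M + idx x + 1
    | Sum.inr j => if j = i then 0 else (N + 1) * M + 1 + idI j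
  have hlt : ∀ i (x : T), (x.1 i : ℕ) * M + idx x + 1 < (N + 1) * M + 1 := by
    intro i x
    have h1 : (x.1 i : ℕ) ≤ N := Nat.lt_succ_iff.mp (x.1 i).2
    have h2 : (idx x : ℕ) < M := (idx x).2
    nlinarith
  have hr : ∀ i, Function.Injective (r i) := by
    intro i u v huv
    rcases u with x | j <;> rcases v with y | l
    · simp only [r] at huv
      have h1 : (idx x : ℕ) < M := (idx x).2
      have h2 : (idx y : ℕ) < M := (idx y).2
      have h3 : ((x.1 i : ℕ) * M + idx x) % M = ((y.1 i : ℕ) * M + idx y) % M := by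
        congr 1; omega
      rw [Nat.mul_add_mod', Nat.mul_add_mod', Nat.mod_eq_of_lt h1, Nat.mod_eq_of_lt h2] at h3
      rw [idx.injective (Fin.ext h3)]
    · simp only [r] at huv
      have := hlt i x
      split_ifs at huv
      omega
    · simp only [r] at huv
      have := hlt i y
      split_ifs at huv
      omega
    · simp only [r] at huv
      split_ifs at huv with h1 h2
      · rw [h1, h2]
      · omega
      · omega
      · have : (idI j : ℕ) = idI l := by omega
        rw [idI.injective (Fin.ext this)]
  have hcol : ∀ x : T, ∃ i, p x i ≤ f (p x) i := by
    intro x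
    by_contra hcon
    push Not at hcon
    have h1 : ∑ i, f (p x) i < ∑ i, p x i :=
      Finset.sum_lt_sum_of_nonempty Finset.univ_nonempty (fun i _ => hcon i)
    rw [(hp x).2, (hf (hp x)).2] at h1
    exact lt_irrefl _ h1
  choose c hc using hcol
  obtain ⟨S, hS, hScard, hSc⟩ := scarf r hr Sum.inr (by
    intro i x hx
    rcases x with x | j
    · simp [r]
    · have : j ≠ i := fun h => hx (by rw [h])
      simp only [r, if_true, this, if_false]
      omega) (by
    intro i j hij x hx
    rcases x with x | l
    · simp only [r, Ne.symm hij, if_false]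
      have := hlt i x
      omega
    · exact absurd rfl (hx l)) (Sum.elim c id) (fun i => rfl)
  -- the indices without slack
  let C : Finset I := Finset.univ.filter fun i => Sum.inr i ∉ S
  have hleT : ∀ i (x y : T), r i (Sum.inl y) ≤ r i (Sum.inl x) → (y.1 i : ℕ) ≤ x.1 i := by
    intro i x y h
    simp only [r] at h
    by_contra hcon
    push Not at hcon
    have h1 : (idx x : ℕ) < M := (idx x).2
    nlinarith
  have hdom : ∀ y : T, ∃ i ∈ C, ∀ x : T, Sum.inl x ∈ S → (y.1 i : ℕ) ≤ x.1 i := by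
    intro y
    obtain ⟨i, hi⟩ := hS (Sum.inl y)
    refine ⟨i, ?_, fun x hx => hleT i x y (hi _ hx)⟩
    simp only [C, Finset.mem_filter, Finset.mem_univ, true_and]
    intro hmem
    have := hi _ hmem
    simp [r] at this
  obtain ⟨i0⟩ : Nonempty I := inferInstance
  have hCne : C.Nonempty := by
    obtain ⟨y, hy, -⟩ := exists_grid_above N {i0} ⟨i0, by simp⟩ (fun _ => 0) (by simp; omega)
    obtain ⟨i, hi, -⟩ := hdom ⟨y, hy⟩
    exact ⟨i, hi⟩
  have hex : ∀ i ∈ C, ∃ x : T, Sum.inl x ∈ S ∧ c x = i := by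
    intro i hi
    have : i ∈ S.image (Sum.elim c id) := by rw [hSc]; simp
    obtain ⟨u, hu, hui⟩ := Finset.mem_image.mp this
    rcases u with x | j
    · exact ⟨x, hu, hui⟩
    · simp only [Sum.elim_inr, id] at hui
      subst hui
      simp only [C, Finset.mem_filter] at hi
      exact absurd hu hi.2
  obtain ⟨z, hz, -⟩ := hex _ hCne.choose_spec
  have hmin : ∀ i, ∃ x : T, Sum.inl x ∈ S ∧ ∀ y : T, Sum.inl y ∈ S → (x.1 i : ℕ) ≤ y.1 i := by
    intro i
    obtain ⟨x, hx, hx2⟩ := Finset.exists_min_image (Finset.univ.filter fun x : T => Sum.inl x ∈ S)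
      (fun x => (x.1 i : ℕ)) ⟨z, by simpa using hz⟩
    exact ⟨x, by simpa using hx, fun y hy => hx2 y (by simpa using hy)⟩
  choose w hw hw2 using hmin
  have hsum : N < ∑ i ∈ C, (((w i).1 i : ℕ) + 1) := by
    by_contra hcon
    push Not at hcon
    obtain ⟨y, hy, hy2⟩ := exists_grid_above N C hCne (fun i => ((w i).1 i : ℕ)) hcon
    obtain ⟨i, hi, hi2⟩ := hdom ⟨y, hy⟩
    have h1 := hi2 _ (hw i)
    have h2 := hy2 i hi
    simp only at h1
    omega
  let m : I → ℕ := fun i => if i ∈ C then ((w i).1 i : ℕ) else 0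
  have hm1 : N ≤ ∑ i, m i + Fintype.card I := by
    have h1 : ∑ i, m i = ∑ i ∈ C, ((w i).1 i : ℕ) := by
      simp only [m, Finset.sum_ite_mem, Finset.univ_inter]
    have h2 : C.card ≤ Fintype.card I := Finset.card_le_univ C
    rw [Finset.sum_add_distrib, Finset.sum_const, smul_eq_mul, mul_one] at hsum
    omega
  have hm2 : ∀ x : T, Sum.inl x ∈ S → ∀ i, m i ≤ x.1 i := by
    intro x hx i
    simp only [m]
    split_ifs
    · exact hw2 i x hx
    · exact Nat.zero_le _
  have hm3 : ∀ x : T, Sum.inl x ∈ S → ∀ i, (x.1 i : ℕ) ≤ m i + Fintype.card I := by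
    intro x hx i
    have h1 : ∑ i, m i + ∑ i, ((x.1 i : ℕ) - m i) = N := by
      rw [← Finset.sum_add_distrib]
      refine (Finset.sum_congr rfl fun j _ => ?_).trans x.2
      exact Nat.add_sub_cancel' (hm2 x hx j)
    have h2 := Finset.single_le_sum (f := fun i => (x.1 i : ℕ) - m i)
      (fun i _ => Nat.zero_le _) (Finset.mem_univ i)
    omega
  refine ⟨p z, hp z, fun i => ?_⟩
  by_cases hi : i ∈ C
  · right
    obtain ⟨x, hx, hxi⟩ := hex i hi
    refine ⟨p x, hp x, fun j => ?_, hxi ▸ hc x⟩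
    simp only [p]
    rw [← sub_div, abs_div, abs_of_pos hN']
    gcongr
    have a1 : (m j : ℝ) ≤ (x.1 j : ℕ) := by exact_mod_cast hm2 x hx j
    have a2 : (m j : ℝ) ≤ (z.1 j : ℕ) := by exact_mod_cast hm2 z hz j
    have a3 : ((x.1 j : ℕ) : ℝ) ≤ m j + Fintype.card I := by exact_mod_cast hm3 x hx j
    have a4 : ((z.1 j : ℕ) : ℝ) ≤ m j + Fintype.card I := by exact_mod_cast hm3 z hz j
    rw [abs_le]
    constructor <;> linarith
  · left
    simp only [p]
    gcongr
    have := hm3 z hz i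
    simpa [m, hi] using this

lemma brouwer_simplex {I : Type*} [Fintype I] [Nonempty I] (f : (I → ℝ) → (I → ℝ))
    (hf : Set.MapsTo f (stdSimplex ℝ I) (stdSimplex ℝ I))
    (hfc : ContinuousOn f (stdSimplex ℝ I)) :
    ∃ z ∈ stdSimplex ℝ I, f z = z := by
  classical
  obtain ⟨i0⟩ : Nonempty I := inferInstance
  have hne : (stdSimplex ℝ I).Nonempty := ⟨_, single_mem_stdSimplex ℝ i0⟩
  rcases subsingleton_or_nontrivial I with hs | hnt
  · obtain ⟨z, hz⟩ := hne
    refine ⟨z, hz, ?_⟩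
    have huniq : ∀ w ∈ stdSimplex ℝ I, ∀ i, w i = 1 := by
      intro w hw i
      have h := hw.2
      rwa [Fintype.sum_subsingleton _ i] at h
    funext i
    rw [huniq _ (hf hz) i, huniq _ hz i]
  have hK : IsCompact (stdSimplex ℝ I) := isCompact_stdSimplex ℝ I
  have hh : ContinuousOn (fun z => ∑ i, max 0 (z i - f z i)) (stdSimplex ℝ I) := by
    apply continuousOn_finsetSum
    intro i _
    refine (continuous_const.max continuous_id).comp_continuousOn (f := fun z => z i - f z i) ?_
    apply ContinuousOn.sub (continuous_apply i).continuousOn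
    exact (continuous_apply i).comp_continuousOn hfc
  obtain ⟨z, hz, hzmin⟩ := hK.exists_isMinOn hne hh
  have huc := hK.uniformContinuousOn_of_continuous hfc
  rw [Metric.uniformContinuousOn_iff] at huc
  have happrox : ∀ ε > 0, ∃ y ∈ stdSimplex ℝ I, ∀ i, y i - f y i ≤ ε := by
    intro ε hε
    obtain ⟨δ, hδ, hδ2⟩ := huc (ε / 2) (by positivity)
    obtain ⟨N, hN⟩ := exists_nat_gt ((Fintype.card I : ℝ) / min δ (ε / 2))
    have hmpos : 0 < min δ (ε / 2) := lt_min hδ (by positivity)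
    have hcard : (0 : ℝ) < Fintype.card I := by exact_mod_cast Fintype.card_pos
    have hN0 : (0 : ℝ) < N := lt_trans (by positivity) hN
    have hNlt : (Fintype.card I : ℝ) / N < min δ (ε / 2) := by
      rw [div_lt_iff₀ hmpos] at hN
      rw [div_lt_iff₀ hN0]
      linarith
    obtain ⟨y, hy, hy2⟩ := scarf_grid f hf N (by exact_mod_cast hN0)
    refine ⟨y, hy, fun i => ?_⟩
    have hl1 := hNlt.trans_le (min_le_left _ _)
    have hl2 := hNlt.trans_le (min_le_right _ _)
    rcases hy2 i with h | ⟨x, hx, hxy, hxf⟩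
    · have := (hf hy).1 i
      linarith
    · have h1 : dist x y < δ := by
        rw [dist_pi_lt_iff hδ]
        intro j
        rw [Real.dist_eq]
        exact (hxy j).trans_lt hl1
      have h2 := hδ2 x hx y hy h1
      rw [dist_pi_lt_iff (by positivity)] at h2
      have h3 := h2 i
      rw [Real.dist_eq, abs_lt] at h3
      have h4 := abs_le.mp (hxy i)
      linarith
  have hle0 : ∑ i, max 0 (z i - f z i) ≤ 0 := by
    apply le_of_forall_pos_le_add
    intro ε hε
    have hcard : (0 : ℝ) < Fintype.card I := by exact_mod_cast Fintype.card_pos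
    obtain ⟨y, hy, hy2⟩ := happrox (ε / Fintype.card I) (by positivity)
    have h1 : ∑ i, max 0 (z i - f z i) ≤ ∑ i, max 0 (y i - f y i) := hzmin hy
    have h2 : ∑ i, max 0 (y i - f y i) ≤ ∑ _i : I, ε / Fintype.card I :=
      Finset.sum_le_sum fun i _ => max_le (by positivity) (hy2 i)
    rw [Finset.sum_const, Finset.card_univ, nsmul_eq_mul] at h2
    have h3 : (Fintype.card I : ℝ) * (ε / Fintype.card I) = ε := by field_simp
    linarith
  have hle : ∀ i, z i ≤ f z i := by
    intro i
    have h1 := Finset.single_le_sum (f := fun i => max 0 (z i - f z i))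
      (fun i _ => le_max_left _ _) (Finset.mem_univ i)
    have h2 := le_max_right 0 (z i - f z i)
    linarith
  refine ⟨z, hz, ?_⟩
  funext i
  have h1 : ∑ i, z i = ∑ i, f z i := by rw [hz.2, (hf hz).2]
  exact ((Finset.sum_eq_sum_iff_of_le (fun i _ => hle i)).mp h1 i (Finset.mem_univ i)).symm

lemma kakutani_compact {X : Type*} [NormedAddCommGroup X] [NormedSpace ℝ X]
    (K : Set X) (hne : K.Nonempty) (hK : IsCompact K) (hconv : Convex ℝ K)
    (V : X → Set X)
    (hval : ∀ x ∈ K, (V x).Nonempty ∧ IsClosed (V x) ∧ Convex ℝ (V x) ∧ V x ⊆ K)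
    (husc : ∀ x ∈ K, ∀ W : Set X, IsOpen W → V x ⊆ W →
      ∃ N ∈ nhds x, ∀ y ∈ N ∩ K, V y ⊆ W) :
    ∃ x ∈ K, x ∈ V x := by
  classical
  have hv : ∀ x, ∃ y, x ∈ K → y ∈ V x := by
    intro x
    by_cases hx : x ∈ K
    · obtain ⟨y, hy⟩ := (hval x hx).1
      exact ⟨y, fun _ => hy⟩
    · exact ⟨0, fun h => absurd h hx⟩
  choose v hv using hv
  -- approximate fixed points
  have happ : ∀ ε > 0, ∃ x ∈ K, x ∈ convexHull ℝ (v '' (K ∩ Metric.ball x ε)) := by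
    intro ε hε
    obtain ⟨t, htK, htf, htc⟩ := hK.finite_cover_balls hε
    lift t to Finset X using htf
    have htne : Nonempty t := by
      obtain ⟨x, hx⟩ := hne
      have := htc hx
      simp only [Set.mem_iUnion] at this
      obtain ⟨y, hy, -⟩ := this
      exact ⟨⟨y, hy⟩⟩
    let g : (t → ℝ) → X := fun l => ∑ i, l i • v i
    have hgc : Continuous g := by
      apply continuous_finsetSum
      intro i _
      exact (continuous_apply i).smul continuous_const
    have hvK : ∀ i : t, v i ∈ K := fun i => (hval _ (htK i.2)).2.2.2 (hv _ (htK i.2))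
    have hgK : ∀ l ∈ stdSimplex ℝ t, g l ∈ K := by
      intro l hl
      exact hconv.sum_mem (fun i _ => hl.1 i) hl.2 (fun i _ => hvK i)
    let φ : t → X → ℝ := fun i x => max 0 (ε - dist x i)
    have hφc : ∀ i, Continuous (φ i) := fun i =>
      continuous_const.max (continuous_const.sub (continuous_id.dist continuous_const))
    have hφ0 : ∀ i x, 0 ≤ φ i x := fun i x => le_max_left _ _
    have hφpos : ∀ x ∈ K, 0 < ∑ i, φ i x := by
      intro x hx
      have := htc hx
      simp only [Set.mem_iUnion] at this
      obtain ⟨y, hy, hxy⟩ := this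
      rw [Metric.mem_ball] at hxy
      apply Finset.sum_pos' (fun i _ => hφ0 i x)
      exact ⟨⟨y, hy⟩, Finset.mem_univ _, lt_max_of_lt_right (by simpa using hxy)⟩
    let F : (t → ℝ) → (t → ℝ) := fun l i => φ i (g l) / ∑ j, φ j (g l)
    obtain ⟨l, hl, hFl⟩ := brouwer_simplex F (by
      intro l hl
      have hpos := hφpos _ (hgK l hl)
      refine ⟨fun i => div_nonneg (hφ0 _ _) hpos.le, ?_⟩
      simp only [F]
      rw [← Finset.sum_div, div_self hpos.ne']) (by
      rw [continuousOn_pi]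
      intro i
      apply ContinuousOn.div
      · exact ((hφc i).comp hgc).continuousOn
      · exact (continuous_finsetSum _ fun j _ => (hφc j).comp hgc).continuousOn
      · intro l hl
        exact (hφpos _ (hgK l hl)).ne')
    refine ⟨g l, hgK l hl, ?_⟩
    have hsum : ∑ i ∈ Finset.univ.filter (fun i => l i ≠ 0), l i • v i = g l := by
      apply Finset.sum_filter_of_ne
      intro i _ h h0
      exact h (by rw [h0, zero_smul])
    have hsum1 : ∑ i ∈ Finset.univ.filter (fun i => l i ≠ 0), l i = 1 := by
      rw [Finset.sum_filter_ne_zero]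
      exact hl.2
    have hmem : ∑ i ∈ Finset.univ.filter (fun i => l i ≠ 0), l i • v i ∈
        convexHull ℝ (v '' (K ∩ Metric.ball (g l) ε)) := by
      apply (convex_convexHull ℝ _).sum_mem (fun i _ => hl.1 i) hsum1
      intro i hi
      apply subset_convexHull
      refine ⟨i, ⟨htK i.2, ?_⟩, rfl⟩
      simp only [Finset.mem_filter, Finset.mem_univ, true_and] at hi
      rw [Metric.mem_ball, dist_comm]
      by_contra hcon
      push Not at hcon
      apply hi
      rw [← hFl]
      have : φ i (g l) = 0 := max_eq_left (by linarith)
      simp only [F, this, zero_div]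
    rwa [hsum] at hmem
  have hseq : ∀ n : ℕ, ∃ x ∈ K, x ∈ convexHull ℝ (v '' (K ∩ Metric.ball x (1 / ((n : ℝ) + 1)))) :=
    fun n => happ _ (by positivity)
  choose u huK hu using hseq
  obtain ⟨x, hx, ψ, hψ, hlim⟩ := hK.tendsto_subseq huK
  refine ⟨x, hx, ?_⟩
  obtain ⟨-, hVc, hVconv, -⟩ := hval x hx
  rw [← hVc.closure_eq, Metric.mem_closure_iff_infDist_zero (hval x hx).1]
  apply le_antisymm _ Metric.infDist_nonneg
  apply le_of_forall_pos_le_add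
  intro δ hδ
  rw [zero_add]
  obtain ⟨N, hN, hNW⟩ := husc x hx (Metric.thickening δ (V x)) Metric.isOpen_thickening
    (Metric.self_subset_thickening hδ _)
  obtain ⟨η, hη, hηN⟩ := Metric.mem_nhds_iff.mp hN
  have hsmall : Filter.Tendsto (fun n => 1 / ((ψ n : ℝ) + 1)) Filter.atTop (nhds 0) :=
    tendsto_one_div_add_atTop_nhds_zero_nat.comp hψ.tendsto_atTop
  have hev : ∀ᶠ n in Filter.atTop, u (ψ n) ∈ Metric.thickening δ (V x) := by
    have e1 := hsmall.eventually (gt_mem_nhds (show (0 : ℝ) < η / 2 by positivity))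
    have e2 := hlim.eventually (Metric.ball_mem_nhds x (show (0 : ℝ) < η / 2 by positivity))
    filter_upwards [e1, e2] with n h1 h2
    refine convexHull_min ?_ (hVconv.thickening δ) (hu (ψ n))
    rintro _ ⟨y, ⟨hyK, hy⟩, rfl⟩
    refine hNW y ⟨hηN ?_, hyK⟩ (hv y hyK)
    rw [Metric.mem_ball] at hy ⊢
    have := dist_triangle y (u (ψ n)) x
    simp only [Function.comp] at h2
    linarith
  have hlim2 : Filter.Tendsto (fun n => Metric.infDist (u (ψ n)) (V x)) Filter.atTop
      (nhds (Metric.infDist x (V x))) :=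
    ((Metric.continuous_infDist_pt (V x)).tendsto x).comp hlim
  refine le_of_tendsto hlim2 ?_
  filter_upwards [hev] with n hn
  rw [Metric.mem_thickening_iff] at hn
  obtain ⟨z, hz, hzd⟩ := hn
  exact (Metric.infDist_le_dist_of_mem hz).trans hzd.le

/-- `S` is covered by finitely many sets of diameter at most `d`. -/
def FinCov {X : Type*} [PseudoEMetricSpace X] (d : ℝ) (S : Set X) : Prop :=
  ∃ 𝒞 : Finset (Set X), (S ⊆ ⋃ A ∈ 𝒞, A) ∧ ∀ A ∈ 𝒞, Metric.ediam A ≤ ENNReal.ofReal d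

lemma FinCov.mono {X : Type*} [PseudoEMetricSpace X] {d : ℝ} {S T : Set X} (h : FinCov d T)
    (hST : S ⊆ T) : FinCov d S := by
  obtain ⟨𝒞, h1, h2⟩ := h
  exact ⟨𝒞, hST.trans h1, h2⟩

lemma FinCov.single {X : Type*} [PseudoEMetricSpace X] {d : ℝ} {S : Set X}
    (h : Metric.ediam S ≤ ENNReal.ofReal d) : FinCov d S :=
  ⟨{S}, by simp, by simpa using h⟩

lemma FinCov.biUnion {X ι : Type*} [PseudoEMetricSpace X] {d : ℝ} (s : Finset ι) (f : ι → Set X)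
    (h : ∀ i ∈ s, FinCov d (f i)) : FinCov d (⋃ i ∈ s, f i) := by
  classical
  choose! C h1 h2 using h
  refine ⟨s.biUnion C, ?_, ?_⟩
  · intro x hx
    simp only [Set.mem_iUnion, Finset.mem_biUnion] at hx ⊢
    obtain ⟨i, hi, hxi⟩ := hx
    have := h1 i hi hxi
    simp only [Set.mem_iUnion] at this
    obtain ⟨A, hA, hxA⟩ := this
    exact ⟨A, ⟨i, hi, hA⟩, hxA⟩
  · intro A hA
    obtain ⟨i, hi, hA⟩ := Finset.mem_biUnion.mp hA
    exact h2 i hi A hA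

lemma FinCov.closure {X : Type*} [PseudoEMetricSpace X] {d : ℝ} {S : Set X} (h : FinCov d S) :
    FinCov d (closure S) := by
  classical
  obtain ⟨𝒞, h1, h2⟩ := h
  refine FinCov.mono (T := ⋃ A ∈ 𝒞, _root_.closure A) ?_ ?_
  · apply FinCov.biUnion
    intro A hA
    apply FinCov.single
    rw [Metric.ediam_closure]
    exact h2 A hA
  · apply closure_minimal
    · refine h1.trans ?_
      exact Set.iUnion₂_mono fun A _ => subset_closure
    · exact 𝒞.finite_toSet.isClosed_biUnion fun A _ => isClosed_closure

section
variable {X : Type*} [NormedAddCommGroup X] [NormedSpace ℝ X]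

lemma FinCov.join {d ε : ℝ} (hd : 0 ≤ d) (hε : 0 < ε) (A B : Set X)
    (hA : Metric.ediam A ≤ ENNReal.ofReal d) (hB : Metric.ediam B ≤ ENNReal.ofReal d) :
    FinCov (d + ε) (convexJoin ℝ A B) := by
  have hbd : ∀ {A : Set X}, Metric.ediam A ≤ ENNReal.ofReal d → ∀ x ∈ A, ∀ y ∈ A, ‖x - y‖ ≤ d := by
    intro A hA x hx y hy
    have := (Metric.edist_le_ediam_of_mem hx hy).trans hA
    rw [edist_dist, ENNReal.ofReal_le_ofReal_iff hd, dist_eq_norm] at this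
    exact this
  have hAb : Bornology.IsBounded A := by
    rw [Metric.isBounded_iff_ediam_ne_top]
    exact ne_top_of_le_ne_top ENNReal.ofReal_ne_top hA
  have hBb : Bornology.IsBounded B := by
    rw [Metric.isBounded_iff_ediam_ne_top]
    exact ne_top_of_le_ne_top ENNReal.ofReal_ne_top hB
  obtain ⟨M, hM⟩ := (hAb.union hBb).exists_norm_le
  have hM' : ∀ a ∈ A, ∀ b ∈ B, ‖a - b‖ ≤ 2 * |M| + 1 := by
    intro a ha b hb
    have h1 := hM a (Or.inl ha)
    have h2 := hM b (Or.inr hb)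
    have h3 := norm_sub_le a b
    have h4 := le_abs_self M
    linarith
  set R := 2 * |M| + 1 with hR
  have hRpos : 0 < R := by positivity
  obtain ⟨F, hF01, hFf, hFc⟩ := (isCompact_Icc (a := (0 : ℝ)) (b := 1)).finite_cover_balls
    (e := ε / (2 * R)) (by positivity)
  lift F to Finset ℝ using hFf
  refine FinCov.mono (T := ⋃ t ∈ F, {x | ∃ s ∈ Set.Icc (0 : ℝ) 1, s ∈ Metric.ball t (ε / (2 * R)) ∧
    ∃ a ∈ A, ∃ b ∈ B, x = (1 - s) • a + s • b}) ?_ ?_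
  · apply FinCov.biUnion
    intro t _
    apply FinCov.single
    apply Metric.ediam_le
    rintro x ⟨s, hs, hst, a, ha, b, hb, rfl⟩ y ⟨s', hs', hst', a', ha', b', hb', rfl⟩
    rw [edist_dist]
    apply ENNReal.ofReal_le_ofReal
    rw [dist_eq_norm]
    have e1 : (1 - s) • a + s • b - ((1 - s') • a' + s' • b') =
        (1 - s) • (a - a') + s • (b - b') + (s' - s) • (a' - b') := by
      module
    rw [e1]
    have n1 : ‖(1 - s) • (a - a')‖ ≤ (1 - s) * d := by
      rw [norm_smul, Real.norm_of_nonneg (by linarith [hs.2])]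
      exact mul_le_mul_of_nonneg_left (hbd hA a ha a' ha') (by linarith [hs.2])
    have n2 : ‖s • (b - b')‖ ≤ s * d := by
      rw [norm_smul, Real.norm_of_nonneg hs.1]
      exact mul_le_mul_of_nonneg_left (hbd hB b hb b' hb') hs.1
    have n3 : ‖(s' - s) • (a' - b')‖ ≤ ε := by
      rw [norm_smul, Real.norm_eq_abs]
      rw [Metric.mem_ball, Real.dist_eq] at hst hst'
      have h1 : |s' - s| ≤ ε / R := by
        have := abs_sub_le s' t s
        rw [abs_sub_comm t s] at this
        have h2 : ε / (2 * R) + ε / (2 * R) = ε / R := by field_simp; norm_num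
        linarith
      calc |s' - s| * ‖a' - b'‖ ≤ ε / R * R :=
            mul_le_mul h1 (hM' a' ha' b' hb') (norm_nonneg _) (by positivity)
        _ = ε := by field_simp
    have n4 := norm_add_le ((1 - s) • (a - a') + s • (b - b')) ((s' - s) • (a' - b'))
    have n5 := norm_add_le ((1 - s) • (a - a')) (s • (b - b'))
    linarith
  · intro x hx
    rw [mem_convexJoin] at hx
    obtain ⟨a, ha, b, hb, hxab⟩ := hx
    rw [segment_eq_image] at hxab
    obtain ⟨s, hs, rfl⟩ := hxab
    have := hFc hs
    simp only [Set.mem_iUnion] at this ⊢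
    obtain ⟨t, ht, hst⟩ := this
    exact ⟨t, ht, s, hs, hst, a, ha, b, hb, rfl⟩

lemma finCov_convexHull_sUnion {d : ℝ} (hd : 0 ≤ d) (𝒞 : Finset (Set X))
    (h : ∀ A ∈ 𝒞, Metric.ediam A ≤ ENNReal.ofReal d) :
    ∀ ε > 0, FinCov (d + ε) (convexHull ℝ (⋃ A ∈ 𝒞, A)) := by
  classical
  induction 𝒞 using Finset.induction_on with
  | empty =>
    intro ε _
    exact ⟨∅, by simp, by simp⟩
  | insert A 𝒞 _ ih =>
    intro ε hε
    have ih' := ih (fun B hB => h B (Finset.mem_insert_of_mem hB)) (ε / 2) (by positivity)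
    have hA := h A (Finset.mem_insert_self _ _)
    have hA' : Metric.ediam (convexHull ℝ A) ≤ ENNReal.ofReal (d + ε / 2) := by
      rw [convexHull_ediam]
      exact hA.trans (ENNReal.ofReal_le_ofReal (by linarith))
    have hle : ENNReal.ofReal (d + ε / 2) ≤ ENNReal.ofReal (d + ε) :=
      ENNReal.ofReal_le_ofReal (by linarith)
    rw [Finset.set_biUnion_insert]
    rcases Set.eq_empty_or_nonempty A with rfl | hAne
    · rw [Set.empty_union]
      obtain ⟨𝒟, h1, h2⟩ := ih'
      exact ⟨𝒟, h1, fun B hB => (h2 B hB).trans hle⟩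
    rcases Set.eq_empty_or_nonempty (⋃ A ∈ 𝒞, A) with h0 | hne
    · rw [h0, Set.union_empty]
      exact FinCov.single (hA'.trans hle)
    rw [convexHull_union hAne hne]
    obtain ⟨𝒟, h1, h2⟩ := ih'
    refine FinCov.mono (T := ⋃ B ∈ 𝒟, convexJoin ℝ (convexHull ℝ A) B) ?_ ?_
    · apply FinCov.biUnion
      intro B hB
      have := FinCov.join (d := d + ε / 2) (ε := ε / 2) (by positivity) (by positivity) _ B hA' (h2 B hB)
      rwa [add_assoc, add_halves] at this
    · intro x hx
      rw [mem_convexJoin] at hx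
      obtain ⟨a, ha, b, hb, hxab⟩ := hx
      have := h1 hb
      simp only [Set.mem_iUnion] at this ⊢
      obtain ⟨B, hB, hbB⟩ := this
      exact ⟨B, hB, mem_convexJoin.mpr ⟨a, ha, b, hbB, hxab⟩⟩

lemma FinCov.closedConvexHull {d ε : ℝ} (hd : 0 ≤ d) (hε : 0 < ε) {S : Set X} (h : FinCov d S) :
    FinCov (d + ε) (_root_.closure (convexHull ℝ S)) := by
  obtain ⟨𝒞, h1, h2⟩ := h
  exact ((finCov_convexHull_sUnion hd 𝒞 h2 ε hε).mono (convexHull_mono h1)).closure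

end

/-- **Fixed point theorem for u.s.c. condensing multivalued maps (Theorem 3.1).**
Let `D` be a nonempty bounded closed convex subset of a Banach space `X` and let
`V : D → 2^X \ {∅}` be an upper semicontinuous condensing multivalued map whose values
are nonempty closed convex subsets of `D`.  Then `V` has a fixed point. -/
theorem stmt9 {X : Type*} [NormedAddCommGroup X] [NormedSpace ℝ X] [CompleteSpace X]
    (D : Set X) (hne : D.Nonempty) (hbdd : Bornology.IsBounded D)
    (hcl : IsClosed D) (hconv : Convex ℝ D)
    (V : X → Set X)
    (hval : ∀ x ∈ D, (V x).Nonempty ∧ IsClosed (V x) ∧ Convex ℝ (V x) ∧ V x ⊆ D)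
    (husc : ∀ x ∈ D, ∀ W : Set X, IsOpen W → V x ⊆ W →
      ∃ N ∈ nhds x, ∀ y ∈ N ∩ D, V y ⊆ W)
    (hcond : ∀ Ω ⊆ D, Bornology.IsBounded Ω → 0 < kuratowski Ω →
      kuratowski (⋃ x ∈ Ω, V x) < kuratowski Ω) :
    ∃ x ∈ D, x ∈ V x := by
  classical
  obtain ⟨x0, hx0⟩ := hne
  let Fam : Set (Set X) := {C | IsClosed C ∧ Convex ℝ C ∧ C ⊆ D ∧ x0 ∈ C ∧ ∀ x ∈ C, V x ⊆ C}
  have hDF : D ∈ Fam := ⟨hcl, hconv, subset_rfl, hx0, fun x hx => (hval x hx).2.2.2⟩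
  let B : Set X := ⋂₀ Fam
  have hBD : B ⊆ D := Set.sInter_subset_of_mem hDF
  have hx0B : x0 ∈ B := Set.mem_sInter.mpr fun C hC => hC.2.2.2.1
  have hBcl : IsClosed B := isClosed_sInter fun C hC => hC.1
  have hBconv : Convex ℝ B := convex_sInter fun C hC => hC.2.1
  have hVB : ∀ x ∈ B, V x ⊆ B := by
    intro x hx y hy
    exact Set.mem_sInter.mpr fun C hC => hC.2.2.2.2 x (Set.mem_sInter.mp hx C hC) hy
  let VB : Set X := ⋃ x ∈ B, V x
  have hVBB : VB ⊆ B := Set.iUnion₂_subset hVB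
  let C : Set X := closure (convexHull ℝ (VB ∪ {x0}))
  have hCB : C ⊆ B := by
    apply closure_minimal _ hBcl
    apply convexHull_min _ hBconv
    exact Set.union_subset hVBB (by simpa using hx0B)
  have hsubC : VB ∪ {x0} ⊆ C := (subset_convexHull ℝ _).trans subset_closure
  have hCF : C ∈ Fam := by
    refine ⟨isClosed_closure, (convex_convexHull ℝ _).closure, hCB.trans hBD,
      hsubC (Or.inr rfl), ?_⟩
    intro x hx y hy
    exact hsubC (Or.inl (Set.mem_biUnion (hCB hx) hy))
  have hBC : B ⊆ C := Set.sInter_subset_of_mem hCF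
  have hkdef : ∀ S : Set X, kuratowski S = sInf {d : ℝ | 0 < d ∧ FinCov d S} := fun S => rfl
  have hbelow : ∀ S : Set X, BddBelow {d : ℝ | 0 < d ∧ FinCov d S} :=
    fun S => ⟨0, fun d hd => hd.1.le⟩
  have hnon : ∀ S ⊆ D, {d : ℝ | 0 < d ∧ FinCov d S}.Nonempty := by
    intro S hS
    have hSb := hbdd.subset hS
    refine ⟨Metric.diam S + 1, by have := Metric.diam_nonneg (s := S); linarith, ?_⟩
    apply FinCov.single
    apply Metric.ediam_le
    intro x hx y hy
    rw [edist_dist]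
    apply ENNReal.ofReal_le_ofReal
    have := Metric.dist_le_diam_of_mem hSb hx hy
    linarith
  have hk0 : kuratowski B ≤ 0 := by
    by_contra hcon
    push Not at hcon
    have hlt := hcond B hBD (hbdd.subset hBD) hcon
    change kuratowski VB < kuratowski B at hlt
    rw [hkdef VB] at hlt
    obtain ⟨d, ⟨hd0, hdc⟩, hdlt⟩ := exists_lt_of_csInf_lt (hnon VB (hVBB.trans hBD)) hlt
    have hcov : FinCov d (VB ∪ {x0}) := by
      obtain ⟨𝒞, h1, h2⟩ := hdc
      refine ⟨insert {x0} 𝒞, ?_, ?_⟩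
      · rw [Finset.set_biUnion_insert, Set.union_comm]
        exact Set.union_subset_union_right _ h1
      · intro A hA
        rcases Finset.mem_insert.mp hA with rfl | hA
        · simp
        · exact h2 A hA
    have h3 := (hcov.closedConvexHull hd0.le
      (show 0 < (kuratowski B - d) / 2 by linarith)).mono hBC
    have h4 : kuratowski B ≤ d + (kuratowski B - d) / 2 := by
      conv_lhs => rw [hkdef]
      exact csInf_le (hbelow B) ⟨by linarith, h3⟩
    linarith
  have htb : TotallyBounded B := by
    rw [Metric.totallyBounded_iff]
    intro ε hε
    have hlt : sInf {d : ℝ | 0 < d ∧ FinCov d B} < ε := by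
      rw [← hkdef]; linarith
    obtain ⟨d, ⟨hd0, 𝒞, h1, h2⟩, hdlt⟩ := exists_lt_of_csInf_lt (hnon B hBD) hlt
    have hch : ∀ A : Set X, ∃ a, A.Nonempty → a ∈ A := by
      intro A
      by_cases hA : A.Nonempty
      · exact ⟨hA.choose, fun h => hA.choose_spec⟩
      · exact ⟨x0, fun h => absurd h hA⟩
    choose a ha using hch
    refine ⟨a '' 𝒞, 𝒞.finite_toSet.image a, ?_⟩
    intro x hx
    have := h1 hx
    simp only [Set.mem_iUnion] at this
    obtain ⟨A, hA, hxA⟩ := this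
    refine Set.mem_biUnion (Set.mem_image_of_mem a hA) ?_
    rw [Metric.mem_ball]
    have h5 := (Metric.edist_le_ediam_of_mem hxA (ha A ⟨x, hxA⟩)).trans (h2 A hA)
    rw [edist_dist, ENNReal.ofReal_le_ofReal_iff hd0.le] at h5
    linarith
  have hBcomp : IsCompact B := TotallyBounded.isCompact_of_isClosed htb hBcl
  obtain ⟨x, hx, hxV⟩ := kakutani_compact B ⟨x0, hx0B⟩ hBcomp hBconv V
    (fun x hx => ⟨(hval x (hBD hx)).1, (hval x (hBD hx)).2.1, (hval x (hBD hx)).2.2.1, hVB x hx⟩)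
    (fun x hx W hW hVW => by
      obtain ⟨N, hN, h⟩ := husc x (hBD hx) W hW hVW
      exact ⟨N, hN, fun y hy => h y ⟨hy.1, hBD hy.2⟩⟩)
  exact ⟨x, hBD hx, hxV⟩

end
end
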